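/- arXiv:1610.01294 — 3 statements merged into one kernel-verified Lean document; each statement's English description precedes it below -/
import Mathlib

section
/- Let n ∈ ℕ, n ≥ 1, α > 0, β ≠ 0, and let v₁, v₂ ∈ ℝⁿ with (v₁, v₂) ≠ (0, 0). Define g : ℝ_{≥0} → ℝ by g(t) := e^{2αt} ‖sin(βt) v₁ + cos(βt) v₂‖². Then there exists t₀ > 0 with g′(t₀) > 0. -/
open Matrix

theorem exists_deriv_pos_of_lt {f : ℝ → ℝ} (hf : Differentiable ℝ f) {a b : ℝ} (hab : a < b)
    (h : f a < f b) : ∃ c, a < c ∧ 0 < deriv f c := by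
  obtain ⟨c, hc, hc'⟩ := exists_deriv_eq_slope f hab hf.continuous.continuousOn
    hf.differentiableOn
  exact ⟨c, hc.1, hc' ▸ div_pos (sub_pos.2 h) (sub_pos.2 hab)⟩

theorem stmt6 {n : ℕ} (hn : 1 ≤ n) (α β : ℝ) (hα : 0 < α) (hβ : β ≠ 0)
    (v₁ v₂ : Fin n → ℝ) (hv : ¬(v₁ = 0 ∧ v₂ = 0))
    (g : ℝ → ℝ)
    (hg : ∀ t, g t = Real.exp (2 * α * t) *
      ((Real.sin (β * t) • v₁ + Real.cos (β * t) • v₂) ⬝ᵥ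
        (Real.sin (β * t) • v₁ + Real.cos (β * t) • v₂))) :
    ∃ t₀ : ℝ, 0 < t₀ ∧ 0 < deriv g t₀ := by
  have pos_of_ne {v : Fin n → ℝ} (h : v ≠ 0) : 0 < v ⬝ᵥ v := by
    have h0 : 0 ≤ v ⬝ᵥ v := Finset.sum_nonneg fun i _ => mul_self_nonneg (v i)
    exact h0.lt_of_ne fun h1 => h (dotProduct_self_eq_zero.1 h1.symm)
  have hdiff : Differentiable ℝ g := by
    rw [funext hg]
    simp only [dotProduct, Pi.add_apply, Pi.smul_apply, smul_eq_mul]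
    fun_prop
  have hT : 0 < 2 * Real.pi / |β| := by positivity
  have hβT : β * (2 * Real.pi / |β|) = 2 * Real.pi ∨ β * (2 * Real.pi / |β|) = -(2 * Real.pi) := by
    rcases abs_cases β with ⟨h, _⟩ | ⟨h, _⟩ <;> rw [h]
    · left; field_simp
    · right; field_simp
  generalize 2 * Real.pi / |β| = T at hT hβT
  have hpos : ∃ a, 0 < a ∧ 0 < g a := by
    by_cases h2 : v₂ = 0
    · have h1 : v₁ ≠ 0 := fun h1 => hv ⟨h1, h2⟩
      refine ⟨T / 4, by positivity, ?_⟩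
      have hs : Real.sin (β * (T / 4)) * Real.sin (β * (T / 4)) = 1 := by
        rcases hβT with h | h
        · rw [show β * (T / 4) = Real.pi / 2 by linarith]; simp
        · rw [show β * (T / 4) = -(Real.pi / 2) by linarith]; simp
      rw [hg, h2, smul_zero, add_zero, smul_dotProduct, dotProduct_smul, smul_smul, hs, one_smul]
      exact mul_pos (Real.exp_pos _) (pos_of_ne h1)
    · refine ⟨T, hT, ?_⟩
      rw [hg]
      refine mul_pos (Real.exp_pos _) ?_
      rcases hβT with h | h <;> simpa [h] using pos_of_ne h2
  obtain ⟨a, ha, hga⟩ := hpos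
  have hper : g (a + T) = Real.exp (2 * α * T) * g a := by
    rw [hg, hg a, mul_add β, mul_add (2 * α), Real.exp_add]
    rcases hβT with h | h <;> rw [h]
    · rw [Real.sin_add_two_pi, Real.cos_add_two_pi]; ring
    · rw [← sub_eq_add_neg, Real.sin_sub_two_pi, Real.cos_sub_two_pi]; ring
  have hlt : g a < g (a + T) := by
    rw [hper]
    exact lt_mul_of_one_lt_left hga (Real.one_lt_exp_iff.2 (by positivity))
  obtain ⟨c, hc, hc'⟩ := exists_deriv_pos_of_lt hdiff (lt_add_of_pos_right a hT) hlt
  exact ⟨c, ha.trans hc, hc'⟩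
end

section
/- Let λ ∈ ℂ with λ ≠ 0, let a, b ∈ ℝ, T > 0 and k ≥ 2/T, and let u₁ : [0,T] → ℝ be given by u₁ = a·χ_{[0,1/k]} + b·χ_{[T−1/k,T]}. Then ∫₀ᵀ ∫₀ᵗ e^{λ(t−τ)} u₁(τ) u₁(t) dτ dt = ((a² + b²)/λ²)(e^{λ/k} − 1) + (ab/λ²) e^{λT} (1 − e^{−λ/k})² − (a² + b²)/(kλ). -/
open MeasureTheory in
theorem intervalIntegrable_and_integral_eq_of_eqOn_Ioo {f g : ℝ → ℂ} {p q : ℝ} (hpq : p ≤ q)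
    (hg : Continuous g) (hfg : ∀ x ∈ Set.Ioo p q, f x = g x) :
    IntervalIntegrable f volume p q ∧ ∫ x in p..q, f x = ∫ x in p..q, g x := by
  have hae : g =ᵐ[volume.restrict (Set.uIoc p q)] f := by
    rw [Set.uIoc_of_le hpq, ← restrict_Ioo_eq_restrict_Ioc]
    filter_upwards [ae_restrict_mem measurableSet_Ioo] with x hx
    exact (hfg x hx).symm
  exact ⟨(hg.intervalIntegrable p q).congr_ae hae,
    intervalIntegral.integral_congr_ae_restrict hae.symm⟩

theorem integral_eq_add_of_eqOn_Ioo {f g₁ g₂ : ℝ → ℂ} {p q r s : ℝ} (hpq : p ≤ q) (hqr : q ≤ r)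
    (hrs : r ≤ s) (hg₁ : Continuous g₁) (hg₂ : Continuous g₂)
    (h₁ : ∀ x ∈ Set.Ioo p q, f x = g₁ x) (h₀ : ∀ x ∈ Set.Ioo q r, f x = 0)
    (h₂ : ∀ x ∈ Set.Ioo r s, f x = g₂ x) :
    ∫ x in p..s, f x = (∫ x in p..q, g₁ x) + ∫ x in r..s, g₂ x := by
  obtain ⟨i₁, e₁⟩ := intervalIntegrable_and_integral_eq_of_eqOn_Ioo hpq hg₁ h₁
  obtain ⟨i₀, e₀⟩ := intervalIntegrable_and_integral_eq_of_eqOn_Ioo hqr continuous_const h₀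
  obtain ⟨i₂, e₂⟩ := intervalIntegrable_and_integral_eq_of_eqOn_Ioo hrs hg₂ h₂
  rw [← intervalIntegral.integral_add_adjacent_intervals (i₁.trans i₀) i₂,
    ← intervalIntegral.integral_add_adjacent_intervals i₁ i₀, e₁, e₀, e₂]
  simp

theorem integral_exp_mul_sub_mul {lam : ℂ} (hlam : lam ≠ 0) (p q : ℝ) (z c d : ℂ) :
    ∫ x in p..q, Complex.exp (lam * (z - (x : ℂ))) * c * d =
      (Complex.exp (lam * (z - p)) - Complex.exp (lam * (z - q))) / lam * c * d := by
  have h : ∀ x : ℝ, Complex.exp (lam * (z - (x : ℂ))) * c * d =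
      Complex.exp (lam * z) * c * d * Complex.exp (-lam * x) := fun x ↦ by
    rw [show lam * (z - x) = lam * z + -lam * x by ring, Complex.exp_add]; ring
  have hp := h p
  have hq := h q
  simp only [h]
  rw [intervalIntegral.integral_const_mul, integral_exp_mul_complex (neg_ne_zero.2 hlam)]
  field_simp
  rw [neg_mul] at hp hq
  linear_combination hq - hp


theorem stmt10 (lam : ℂ) (hlam : lam ≠ 0) (a b T k : ℝ) (hT : 0 < T)
    (hk : 2 / T ≤ k)
    (u₁ : ℝ → ℝ)
    (hu₁ : ∀ t, u₁ t = a * Set.indicator (Set.Icc (0:ℝ) (1 / k)) 1 t +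
        b * Set.indicator (Set.Icc (T - 1 / k) T) 1 t) :
    (∫ t in (0:ℝ)..T, ∫ τ in (0:ℝ)..t,
        Complex.exp (lam * (↑t - ↑τ)) * (u₁ τ : ℂ) * (u₁ t : ℂ)) =
      ((a:ℂ) ^ 2 + (b:ℂ) ^ 2) / lam ^ 2 * (Complex.exp (lam / (k:ℂ)) - 1) +
        (a:ℂ) * (b:ℂ) / lam ^ 2 * Complex.exp (lam * (T:ℂ)) *
          (1 - Complex.exp (-(lam / (k:ℂ)))) ^ 2 -
        ((a:ℂ) ^ 2 + (b:ℂ) ^ 2) / ((k:ℂ) * lam) := by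
  have hk₀ : 0 < k := lt_of_lt_of_le (by positivity) hk
  obtain ⟨h, rfl⟩ : ∃ h, k = 1 / h := ⟨1 / k, by simp⟩
  have hh : 0 < h := by simpa using hk₀
  have hhT : h ≤ T - h := by
    rw [div_le_div_iff₀ hT hh] at hk
    linarith
  simp only [one_div_one_div] at hu₁
  have u_left : ∀ t ∈ Set.Ioo 0 h, u₁ t = a := fun t ht ↦ by
    have h₁ : t ∈ Set.Icc 0 h := ⟨ht.1.le, ht.2.le⟩
    have h₂ : t ∉ Set.Icc (T - h) T := fun hm ↦ by linarith [hm.1, ht.2]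
    simp [hu₁, Set.indicator_of_mem h₁, Set.indicator_of_notMem h₂]
  have u_mid : ∀ t ∈ Set.Ioo h (T - h), u₁ t = 0 := fun t ht ↦ by
    have h₁ : t ∉ Set.Icc 0 h := fun hm ↦ by linarith [hm.2, ht.1]
    have h₂ : t ∉ Set.Icc (T - h) T := fun hm ↦ by linarith [hm.1, ht.2]
    simp [hu₁, Set.indicator_of_notMem h₁, Set.indicator_of_notMem h₂]
  have u_right : ∀ t ∈ Set.Ioo (T - h) T, u₁ t = b := fun t ht ↦ by
    have h₁ : t ∉ Set.Icc 0 h := fun hm ↦ by linarith [hm.2, ht.1]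
    have h₂ : t ∈ Set.Icc (T - h) T := ⟨ht.1.le, ht.2.le⟩
    simp [hu₁, Set.indicator_of_notMem h₁, Set.indicator_of_mem h₂]
  have cont : ∀ (z : ℂ) (c d : ℂ),
      Continuous fun x : ℝ ↦ Complex.exp (lam * (z - (x : ℂ))) * c * d := by
    intros; fun_prop
  have inner_left : ∀ t ∈ Set.Ioo 0 h, (∫ τ in (0:ℝ)..t,
      Complex.exp (lam * (↑t - ↑τ)) * (u₁ τ : ℂ) * (u₁ t : ℂ)) =
        (Complex.exp (lam * t) - 1) / lam * a * a := fun t ht ↦ by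
    rw [(intervalIntegrable_and_integral_eq_of_eqOn_Ioo ht.1.le (cont t a a) fun τ hτ ↦ by
      rw [u_left τ ⟨hτ.1, hτ.2.trans ht.2⟩, u_left t ht]).2, integral_exp_mul_sub_mul hlam]
    simp
  have inner_right : ∀ t ∈ Set.Ioo (T - h) T, (∫ τ in (0:ℝ)..t,
      Complex.exp (lam * (↑t - ↑τ)) * (u₁ τ : ℂ) * (u₁ t : ℂ)) =
        (Complex.exp (lam * t) - Complex.exp (lam * (t - h))) / lam * a * b +
          (Complex.exp (lam * (t - (T - h))) - 1) / lam * b * b := fun t ht ↦ by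
    rw [integral_eq_add_of_eqOn_Ioo hh.le hhT ht.1.le (cont t a b) (cont t b b)
      (fun τ hτ ↦ by rw [u_left τ hτ, u_right t ht])
      (fun τ hτ ↦ by simp [u_mid τ hτ])
      (fun τ hτ ↦ by rw [u_right τ ⟨hτ.1, hτ.2.trans ht.2⟩, u_right t ht]),
      integral_exp_mul_sub_mul hlam, integral_exp_mul_sub_mul hlam]
    simp
  rw [integral_eq_add_of_eqOn_Ioo hh.le hhT (by linarith) (by fun_prop) (by fun_prop) inner_left
    (fun t ht ↦ by simp [u_mid t ht]) inner_right]
  have shift : ∀ (t : ℝ) (w : ℂ), Complex.exp (lam * (t - w)) =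
      Complex.exp (-(lam * w)) * Complex.exp (lam * t) := fun t w ↦ by
    rw [← Complex.exp_add]; ring_nf
  have int_left : ∫ t in (0:ℝ)..h, (Complex.exp (lam * t) - 1) / lam * a * a =
      ((Complex.exp (lam * h) - 1) / lam - h) / lam * a * a := by
    have hi : IntervalIntegrable (fun t : ℝ ↦ Complex.exp (lam * t)) MeasureTheory.volume 0 h :=
      Continuous.intervalIntegrable (by fun_prop) _ _
    simp only [intervalIntegral.integral_mul_const, intervalIntegral.integral_div]
    rw [intervalIntegral.integral_sub hi (by simp), integral_exp_mul_complex hlam]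
    simp
  have int_right : ∫ t in (T - h)..T,
      ((Complex.exp (lam * t) - Complex.exp (lam * (t - h))) / lam * a * b +
        (Complex.exp (lam * (t - (T - h))) - 1) / lam * b * b) =
      ((1 - Complex.exp (-(lam * h))) * a * b + Complex.exp (-(lam * (T - h))) * b * b) / lam *
        ((Complex.exp (lam * T) - Complex.exp (lam * (T - h))) / lam) - h / lam * b * b := by
    have hi : IntervalIntegrable (fun t : ℝ ↦ ((1 - Complex.exp (-(lam * h))) * a * b +
        Complex.exp (-(lam * (T - h))) * b * b) / lam * Complex.exp (lam * t))
        MeasureTheory.volume (T - h) T := Continuous.intervalIntegrable (by fun_prop) _ _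
    rw [intervalIntegral.integral_congr (g := fun t : ℝ ↦
      ((1 - Complex.exp (-(lam * h))) * a * b + Complex.exp (-(lam * (T - h))) * b * b) / lam *
        Complex.exp (lam * t) - 1 / lam * b * b)
      (fun t _ ↦ by simp only [shift]; ring),
      intervalIntegral.integral_sub hi (by simp), intervalIntegral.integral_const_mul,
      integral_exp_mul_complex hlam]
    simp
    ring
  rw [int_left, int_right]
  have e₁ : Complex.exp (lam * (T - h)) = Complex.exp (lam * T) * Complex.exp (-(lam * h)) := by
    rw [← Complex.exp_add]; ring_nf
  have e₂ : Complex.exp (-(lam * (T - h))) = (Complex.exp (lam * T))⁻¹ * Complex.exp (lam * h) := by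
    rw [← Complex.exp_neg, ← Complex.exp_add]; ring_nf
  have hE := Complex.exp_ne_zero (lam * T)
  have hF := Complex.exp_ne_zero (lam * h)
  have hh' : (h : ℂ) ≠ 0 := by exact_mod_cast hh.ne'
  rw [e₁, e₂]
  simp only [Complex.ofReal_div, Complex.ofReal_one, div_div_eq_mul_div, div_one, Complex.exp_neg]
  field_simp
  ring
end

section
/- Let n ∈ ℕ, n ≥ 1. The set N of all A ∈ ℝ^{n×n} such that (a) 0 is not an eigenvalue of A, (b) A has n distinct complex eigenvalues, and (c) there exists an eigenvalue λ of A such that every eigenvalue μ of A with μ ≠ λ and μ ≠ conj(λ) satisfies Re μ < Re λ, is open and dense in ℝ^{n×n} (with respect to the norm topology). -/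
open Matrix

/-- The complex eigenvalues of a real matrix. -/
def eigenvalues {n : ℕ} (A : Matrix (Fin n) (Fin n) ℝ) : Set ℂ :=
  {μ : ℂ | ∃ v : Fin n → ℂ, v ≠ 0 ∧ (A.map (fun x : ℝ => (x : ℂ))).mulVec v = μ • v}

/-- The complexification of a real matrix. -/
local notation "cplx(" A ")" => Matrix.map A (fun x : ℝ => (x : ℂ))

lemma mem_eigenvalues_iff_isRoot {n : ℕ} {A : Matrix (Fin n) (Fin n) ℝ} {μ : ℂ} :
    μ ∈ eigenvalues A ↔ (cplx(A)).charpoly.IsRoot μ := by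
  rw [Polynomial.IsRoot, Matrix.eval_charpoly, ← Matrix.exists_mulVec_eq_zero_iff]
  refine exists_congr fun v => and_congr_right fun _ => ?_
  rw [Matrix.sub_mulVec, sub_eq_zero, Matrix.scalar_apply, ← Matrix.smul_one_eq_diagonal,
    Matrix.smul_mulVec, Matrix.one_mulVec, eq_comm]

lemma eigenvalues_eq_roots_toFinset {n : ℕ} (A : Matrix (Fin n) (Fin n) ℝ) :
    eigenvalues A = ((cplx(A)).charpoly.roots.toFinset : Set ℂ) := by
  ext μ
  simp [mem_eigenvalues_iff_isRoot, (Matrix.charpoly_monic _).ne_zero]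

lemma finite_eigenvalues {n : ℕ} (A : Matrix (Fin n) (Fin n) ℝ) : (eigenvalues A).Finite := by
  rw [eigenvalues_eq_roots_toFinset]
  exact Finset.finite_toSet _

lemma card_roots_charpoly {n : ℕ} (M : Matrix (Fin n) (Fin n) ℂ) :
    M.charpoly.roots.card = n := by
  rw [← (IsAlgClosed.splits M.charpoly).natDegree_eq_card_roots, Matrix.charpoly_natDegree_eq_dim,
    Fintype.card_fin]

lemma ncard_eigenvalues_le {n : ℕ} (A : Matrix (Fin n) (Fin n) ℝ) :
    (eigenvalues A).ncard ≤ n := by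
  rw [eigenvalues_eq_roots_toFinset, Set.ncard_coe_finset]
  exact (Multiset.toFinset_card_le _).trans_eq (card_roots_charpoly _)

lemma ncard_eigenvalues_of_separable {n : ℕ} {A : Matrix (Fin n) (Fin n) ℝ}
    (h : (cplx(A)).charpoly.Separable) : (eigenvalues A).ncard = n := by
  rw [eigenvalues_eq_roots_toFinset, Set.ncard_coe_finset,
    Multiset.toFinset_card_of_nodup (Polynomial.nodup_roots h), card_roots_charpoly]

lemma conj_mem_eigenvalues {n : ℕ} {A : Matrix (Fin n) (Fin n) ℝ} {μ : ℂ}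
    (h : μ ∈ eigenvalues A) : starRingEnd ℂ μ ∈ eigenvalues A := by
  obtain ⟨v, hv, h⟩ := h
  refine ⟨star v, by simpa using hv, funext fun i => ?_⟩
  have := congrArg (starRingEnd ℂ) (congrFun h i)
  simpa [Matrix.mulVec, dotProduct] using this

/-- If `n` distinct eigenvalues of `B` are obtained injectively from those of `A`, they are all
the eigenvalues of `B`. -/
lemma image_eigenvalues_eq {n : ℕ} {A B : Matrix (Fin n) (Fin n) ℝ} {f : ℂ → ℂ}
    (hA : (eigenvalues A).ncard = n) (hf : Set.MapsTo f (eigenvalues A) (eigenvalues B))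
    (hinj : Set.InjOn f (eigenvalues A)) : f '' eigenvalues A = eigenvalues B := by
  refine Set.eq_of_subset_of_ncard_le hf.image_subset ?_ (finite_eigenvalues B)
  rw [hinj.ncard_image, hA]
  exact ncard_eigenvalues_le B

lemma pow_card_le_norm_prod {s : Multiset ℂ} {ε : ℝ} (hε : 0 ≤ ε) (h : ∀ x ∈ s, ε ≤ ‖x‖) :
    ε ^ s.card ≤ ‖s.prod‖ := by
  induction s using Multiset.induction_on with
  | empty => simp
  | cons a s ih =>
    rw [Multiset.card_cons, Multiset.prod_cons, norm_mul, pow_succ']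
    have := ih fun x hx => h x (Multiset.mem_cons_of_mem hx)
    have := h a (Multiset.mem_cons_self a s)
    gcongr

lemma eventually_exists_eigenvalue_near {n : ℕ} {A : Matrix (Fin n) (Fin n) ℝ} {μ : ℂ}
    (hμ : μ ∈ eigenvalues A) {ε : ℝ} (hε : 0 < ε) :
    ∀ᶠ B in nhds A, ∃ ν ∈ eigenvalues B, ‖ν - μ‖ < ε := by
  have hcont : Continuous fun B : Matrix (Fin n) (Fin n) ℝ =>
      ‖(Matrix.scalar (Fin n) μ - cplx(B)).det‖ :=
    (continuous_const.sub
      (continuous_id.matrix_map Complex.continuous_ofReal)).matrix_det.norm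
  rw [mem_eigenvalues_iff_isRoot, Polynomial.IsRoot, Matrix.eval_charpoly] at hμ
  have hev : ∀ᶠ B in nhds A, ‖(Matrix.scalar (Fin n) μ - cplx(B)).det‖ < ε ^ n :=
    hcont.continuousAt.eventually_lt continuousAt_const (by simp only [hμ, norm_zero]; positivity)
  filter_upwards [hev] with B hB
  by_contra! hfar
  refine hB.not_ge ?_
  rw [← Matrix.eval_charpoly,
    (IsAlgClosed.splits _).eval_eq_prod_roots_of_monic (Matrix.charpoly_monic _)]
  conv_lhs => rw [← card_roots_charpoly cplx(B), ← Multiset.card_map (μ - ·)]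
  refine pow_card_le_norm_prod hε.le fun x hx => ?_
  obtain ⟨ν, hν, rfl⟩ := Multiset.mem_map.1 hx
  rw [norm_sub_rev]
  exact hfar ν (mem_eigenvalues_iff_isRoot.2 (Polynomial.isRoot_of_mem_roots hν))

/-- A finite family of positive reals, given by a real function on a finite set, has a common
positive strict lower bound for its positive values. -/
lemma Set.Finite.exists_pos_lt {α : Type*} {s : Set α} (hs : s.Finite) (f : α → ℝ) :
    ∃ ε > 0, ∀ x ∈ s, 0 < f x → ε < f x := by
  have : ∀ᶠ ε in nhdsWithin (0 : ℝ) (Set.Ioi 0), ∀ x ∈ s, 0 < f x → ε < f x := by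
    rw [Filter.eventually_all_finite hs]
    intro x _
    by_cases hx : 0 < f x
    · filter_upwards [Ioo_mem_nhdsGT hx] with ε hε _ using hε.2
    · exact Filter.Eventually.of_forall fun _ h => absurd h hx
  obtain ⟨ε, h, hε⟩ := (this.and self_mem_nhdsWithin).exists
  exact ⟨ε, hε, h⟩

lemma isOpen_generic (n : ℕ) :
    IsOpen {A : Matrix (Fin n) (Fin n) ℝ | (0 : ℂ) ∉ eigenvalues A ∧ (eigenvalues A).ncard = n ∧
      ∃ lam ∈ eigenvalues A, ∀ μ ∈ eigenvalues A,
        μ ≠ lam → μ ≠ starRingEnd ℂ lam → μ.re < lam.re} := by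
  rw [isOpen_iff_eventually]
  rintro A ⟨h0, hcard, lam, hlam, hdom⟩
  have hfin := finite_eigenvalues A
  obtain ⟨a, ha, ha'⟩ := hfin.exists_pos_lt (fun μ => ‖μ‖)
  obtain ⟨b, hb, hb'⟩ := (hfin.prod hfin).exists_pos_lt (fun p => ‖p.1 - p.2‖)
  obtain ⟨c, hc, hc'⟩ := hfin.exists_pos_lt (fun μ => lam.re - μ.re)
  obtain ⟨ε, hε, hεa, hεb, hεc⟩ : ∃ ε > 0, ε ≤ a ∧ 2 * ε ≤ b ∧ 2 * ε ≤ c :=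
    ⟨min a (min b c) / 2, by positivity, by grind, by grind, by grind⟩
  have hnear : ∀ᶠ B in nhds A, ∀ μ ∈ eigenvalues A, ∃ ν ∈ eigenvalues B, ‖ν - μ‖ < ε :=
    (Filter.eventually_all_finite hfin).2 fun μ hμ => eventually_exists_eigenvalue_near hμ hε
  filter_upwards [hnear] with B hB
  choose! f hfB hf using hB
  have hsep : ∀ μ ∈ eigenvalues A, ∀ ν ∈ eigenvalues A, ∀ z : ℂ,
      ‖z - μ‖ < ε → ‖z - ν‖ < ε → μ = ν := by
    intro μ hμ ν hν z hzμ hzν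
    by_contra hne
    have h1 := hb' (μ, ν) ⟨hμ, hν⟩ (norm_pos_iff.2 (sub_ne_zero.2 hne))
    have h2 := norm_sub_le_norm_sub_add_norm_sub μ z ν
    rw [norm_sub_rev μ z] at h2
    simp only at h1
    linarith
  have hinj : Set.InjOn f (eigenvalues A) := fun μ hμ ν hν h =>
    hsep μ hμ ν hν (f μ) (hf μ hμ) (h ▸ hf ν hν)
  have himg := image_eigenvalues_eq hcard hfB hinj
  refine ⟨?_, ?_, f lam, hfB lam hlam, ?_⟩
  · rw [← himg]
    rintro ⟨μ, hμ, hfμ⟩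
    have h1 := ha' μ hμ (norm_pos_iff.2 fun h => h0 (h ▸ hμ))
    have h2 := hf μ hμ
    rw [hfμ, zero_sub, norm_neg] at h2
    linarith
  · rw [← himg, hinj.ncard_image, hcard]
  · have hconj : f (starRingEnd ℂ lam) = starRingEnd ℂ (f lam) := by
      have hmem := conj_mem_eigenvalues (hfB lam hlam)
      rw [← himg] at hmem
      obtain ⟨ν, hν, hfν⟩ := hmem
      have hcl : ‖f ν - starRingEnd ℂ lam‖ < ε := by
        rw [hfν, ← map_sub, Complex.norm_conj]
        exact hf lam hlam
      rw [← hfν, hsep ν hν _ (conj_mem_eigenvalues hlam) _ (hf ν hν) hcl]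
    rw [← himg]
    rintro _ ⟨μ, hμ, rfl⟩ hne hne'
    have h1 := hc' μ hμ (sub_pos.2 (hdom μ hμ (fun h => hne (h ▸ rfl))
      (fun h => hne' (by rw [h, hconj]))))
    have h2 := (Complex.abs_re_le_norm _).trans_lt (hf μ hμ)
    have h3 := (Complex.abs_re_le_norm _).trans_lt (hf lam hlam)
    rw [Complex.sub_re, abs_lt] at h2 h3
    linarith

lemma mem_closure_of_eventually_cofinite {E : Type*} [TopologicalSpace E] {γ : ℝ → E}
    (hγ : Continuous γ) {s : Set E} (hs : ∀ᶠ t in Filter.cofinite, γ t ∈ s) :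
    γ 0 ∈ closure s := by
  have hd : Dense {t | γ t ∉ s}ᶜ := (Filter.eventually_cofinite.1 hs).countable.dense_compl ℝ
  refine closure_mono ?_ (image_closure_subset_closure_image hγ ⟨0, hd 0, rfl⟩)
  rintro _ ⟨t, ht, rfl⟩
  simpa using ht

lemma Polynomial.Monic.resultant_derivative_ne_zero_iff {p : Polynomial ℂ} (hp : p.Monic) :
    p.resultant p.derivative p.natDegree p.natDegree ≠ 0 ↔ p.Separable := by
  have hs := IsAlgClosed.splits p
  rw [Polynomial.resultant_eq_prod_eval _ _ _
      (p.natDegree_derivative_le.trans (Nat.sub_le _ _)) hs, hp.leadingCoeff, one_pow, one_mul,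
    Ne, Multiset.prod_eq_zero_iff, Polynomial.separable_def,
    Polynomial.isCoprime_iff_aeval_ne_zero_of_isAlgClosed ℂ ℂ]
  simp only [Multiset.mem_map, Polynomial.mem_roots hp.ne_zero, Polynomial.IsRoot,
    Polynomial.coe_aeval_eq_eval, not_exists, not_and, ← imp_iff_not_or, Ne]

lemma eventually_separable_charpoly_line {n : ℕ} (A B : Matrix (Fin n) (Fin n) ℂ)
    (hB : (A + B).charpoly.Separable) :
    ∀ᶠ t : ℂ in Filter.cofinite, (A + t • B).charpoly.Separable := by
  let M : Matrix (Fin n) (Fin n) (Polynomial ℂ) :=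
    A.map Polynomial.C + (Polynomial.X : Polynomial ℂ) • B.map Polynomial.C
  let R := M.charpoly.resultant M.charpoly.derivative n n
  have hM (t : ℂ) : M.charpoly.map (Polynomial.evalRingHom t) = (A + t • B).charpoly := by
    rw [← Matrix.charpoly_map]
    congr 1
    ext i j
    simp [M, mul_comm t]
  have hR (t : ℂ) : R.eval t ≠ 0 ↔ (A + t • B).charpoly.Separable := by
    rw [← (Matrix.charpoly_monic _).resultant_derivative_ne_zero_iff,
      Matrix.charpoly_natDegree_eq_dim, Fintype.card_fin, ← hM, Polynomial.derivative_map,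
      Polynomial.resultant_map_map, Polynomial.coe_evalRingHom]
  have hR0 : R ≠ 0 := by
    rintro h
    exact (hR 1).2 (by rwa [one_smul]) (by rw [h, Polynomial.eval_zero])
  filter_upwards [(Polynomial.finite_setOfPred_isRoot hR0).compl_mem_cofinite] with t ht
  exact (hR t).1 ht

lemma dense_ncard_eigenvalues (n : ℕ) :
    Dense {A : Matrix (Fin n) (Fin n) ℝ | (eigenvalues A).ncard = n} := by
  intro A
  let D : Matrix (Fin n) (Fin n) ℝ := Matrix.diagonal fun i => (i : ℝ)
  have hD : (cplx(A) + cplx((D - A))).charpoly.Separable := by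
    have : cplx(A) + cplx((D - A)) = Matrix.diagonal fun i : Fin n => ((i : ℕ) : ℂ) := by
      ext i j
      by_cases h : i = j <;> simp [D, h]
    rw [this, Matrix.charpoly_diagonal, Polynomial.separable_prod_X_sub_C_iff]
    exact Nat.cast_injective.comp Fin.val_injective
  suffices h : ∀ᶠ t : ℝ in Filter.cofinite,
      A + t • (D - A) ∈ {A : Matrix (Fin n) (Fin n) ℝ | (eigenvalues A).ncard = n} by
    simpa using mem_closure_of_eventually_cofinite (by fun_prop) h
  filter_upwards [Complex.ofReal_injective.tendsto_cofinite.eventually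
    (eventually_separable_charpoly_line _ _ hD)] with t ht
  refine ncard_eigenvalues_of_separable ?_
  convert ht using 2
  ext i j
  simp

lemma eventually_add_mul_ne_zero {K : Type*} [Field K] [Algebra ℝ K] {a b : K}
    (h : a ≠ 0 ∨ b ≠ 0) : ∀ᶠ t : ℝ in Filter.cofinite, a + algebraMap ℝ K t * b ≠ 0 := by
  refine Filter.eventually_cofinite.2 (Set.Subsingleton.finite fun s hs t ht => ?_)
  simp only [Set.mem_ofPred_eq, not_not] at hs ht
  rcases eq_or_ne b 0 with rfl | hb
  · simp_all
  · exact (algebraMap ℝ K).injective (mul_right_cancel₀ hb (by linear_combination hs - ht))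

lemma add_mul_sq_add_one_mem_eigenvalues {n : ℕ} {A : Matrix (Fin n) (Fin n) ℝ} {μ : ℂ}
    (hμ : μ ∈ eigenvalues A) (t : ℝ) :
    μ + t * (μ ^ 2 + 1) ∈ eigenvalues (A + t • (A * A + 1)) := by
  obtain ⟨v, hv, h⟩ := hμ
  refine ⟨v, hv, ?_⟩
  have : cplx((A + t • (A * A + 1))) = cplx(A) + (t : ℂ) • (cplx(A) * cplx(A) + 1) := by
    ext i j
    by_cases hij : i = j <;> simp [Matrix.mul_apply, hij]
  rw [this, Matrix.add_mulVec, Matrix.smul_mulVec, Matrix.add_mulVec, ← Matrix.mulVec_mulVec, h,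
    Matrix.mulVec_smul, h, Matrix.one_mulVec]
  module

/-- Eigenvalues with the same real part are separated, up to conjugation, by the perturbation
`μ ↦ μ + t * (μ ^ 2 + 1)` for all but finitely many real `t`. -/
lemma eventually_re_add_mul_sq_add_one_ne {μ ν : ℂ} (h : ν ≠ μ) (h' : ν ≠ starRingEnd ℂ μ) :
    ∀ᶠ t : ℝ in Filter.cofinite, (ν + t * (ν ^ 2 + 1)).re ≠ (μ + t * (μ ^ 2 + 1)).re := by
  have key : ν.re - μ.re ≠ 0 ∨ (ν ^ 2).re - (μ ^ 2).re ≠ 0 := by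
    by_contra! hc
    have hre : ν.re = μ.re := sub_eq_zero.1 hc.1
    have him : ν.im ^ 2 = μ.im ^ 2 := by
      have := hc.2
      simp only [sq, Complex.mul_re, hre] at this
      linarith
    rcases sq_eq_sq_iff_eq_or_eq_neg.1 him with hi | hi
    · exact h (Complex.ext hre hi)
    · exact h' (Complex.ext (by simpa using hre) (by simpa using hi))
  filter_upwards [eventually_add_mul_ne_zero key] with t ht heq
  simp only [Complex.add_re, Complex.re_ofReal_mul, Complex.one_re] at heq
  exact ht (by simp only [Algebra.algebraMap_self, RingHom.id_apply]; linarith)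

lemma eventually_add_mul_sq_add_one_ne {μ ν : ℂ} (h : ν ≠ μ) :
    ∀ᶠ t : ℝ in Filter.cofinite, ν + t * (ν ^ 2 + 1) ≠ μ + t * (μ ^ 2 + 1) := by
  filter_upwards [eventually_add_mul_ne_zero (b := ν ^ 2 - μ ^ 2) (Or.inl (sub_ne_zero.2 h))]
    with t ht heq
  exact ht (by rw [Complex.coe_algebraMap]; linear_combination heq)

lemma eventually_add_mul_sq_add_one_ne_zero (μ : ℂ) :
    ∀ᶠ t : ℝ in Filter.cofinite, μ + t * (μ ^ 2 + 1) ≠ 0 :=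
  eventually_add_mul_ne_zero <| by
    rcases eq_or_ne μ 0 with rfl | h
    · right; simp
    · exact Or.inl h

lemma mem_closure_generic {n : ℕ} (hn : 1 ≤ n) {A : Matrix (Fin n) (Fin n) ℝ}
    (hA : (eigenvalues A).ncard = n) :
    A ∈ closure {A : Matrix (Fin n) (Fin n) ℝ | (0 : ℂ) ∉ eigenvalues A ∧
      (eigenvalues A).ncard = n ∧ ∃ lam ∈ eigenvalues A, ∀ μ ∈ eigenvalues A,
        μ ≠ lam → μ ≠ starRingEnd ℂ lam → μ.re < lam.re} := by
  have hE := finite_eigenvalues A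
  let f (t : ℝ) (μ : ℂ) : ℂ := μ + t * (μ ^ 2 + 1)
  have hzero : ∀ᶠ t in Filter.cofinite, ∀ μ ∈ eigenvalues A, f t μ ≠ 0 :=
    (Filter.eventually_all_finite hE).2 fun μ _ => eventually_add_mul_sq_add_one_ne_zero μ
  have hinj : ∀ᶠ t in Filter.cofinite, ∀ μ ∈ eigenvalues A, ∀ ν ∈ eigenvalues A,
      ν ≠ μ → f t ν ≠ f t μ := by
    simp only [Filter.eventually_all_finite hE, Filter.eventually_imp_distrib_left]
    exact fun μ _ ν _ => eventually_add_mul_sq_add_one_ne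
  have hre : ∀ᶠ t in Filter.cofinite, ∀ μ ∈ eigenvalues A, ∀ ν ∈ eigenvalues A,
      ν ≠ μ → ν ≠ starRingEnd ℂ μ → (f t ν).re ≠ (f t μ).re := by
    simp only [Filter.eventually_all_finite hE, Filter.eventually_imp_distrib_left]
    exact fun μ _ ν _ => eventually_re_add_mul_sq_add_one_ne
  suffices h : ∀ᶠ t : ℝ in Filter.cofinite, A + t • (A * A + 1) ∈
      {A : Matrix (Fin n) (Fin n) ℝ | (0 : ℂ) ∉ eigenvalues A ∧ (eigenvalues A).ncard = n ∧
        ∃ lam ∈ eigenvalues A, ∀ μ ∈ eigenvalues A,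
          μ ≠ lam → μ ≠ starRingEnd ℂ lam → μ.re < lam.re} by
    simpa using mem_closure_of_eventually_cofinite (by fun_prop) h
  filter_upwards [hzero, hinj, hre] with t h0 h1 h2
  have hft : Set.InjOn (f t) (eigenvalues A) := fun ν hν μ hμ h => by
    by_contra hne
    exact h1 μ hμ ν hν hne h
  have himg := image_eigenvalues_eq (B := A + t • (A * A + 1)) hA
    (fun μ hμ => add_mul_sq_add_one_mem_eigenvalues hμ t) hft
  change f t '' _ = _ at himg
  simp only [← himg]
  refine ⟨fun ⟨μ, hμ, h⟩ => h0 μ hμ h, by rw [hft.ncard_image, hA], ?_⟩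
  have hne : (eigenvalues A).Nonempty := (Set.ncard_pos hE).1 (by omega)
  obtain ⟨lam, hlam, hmax⟩ := hE.exists_maximalFor (fun μ => (f t μ).re) _ hne
  refine ⟨f t lam, ⟨lam, hlam, rfl⟩, ?_⟩
  rintro _ ⟨μ, hμ, rfl⟩ hμl hμc
  have hle : (f t μ).re ≤ (f t lam).re := (le_total _ _).elim id (hmax hμ)
  refine hle.lt_of_ne (h2 lam hlam μ hμ (fun h => hμl (h ▸ rfl)) fun h => hμc ?_)
  simp [f, h]

theorem stmt14 {n : ℕ} (hn : 1 ≤ n)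
    (N : Set (Matrix (Fin n) (Fin n) ℝ))
    (hN : N = {A | (0:ℂ) ∉ eigenvalues A ∧ (eigenvalues A).ncard = n ∧
      ∃ lam ∈ eigenvalues A, ∀ μ ∈ eigenvalues A,
        μ ≠ lam → μ ≠ starRingEnd ℂ lam → μ.re < lam.re}) :
    IsOpen N ∧ Dense N := by
  subst hN
  refine ⟨isOpen_generic n, dense_closure.1 ?_⟩
  exact (dense_ncard_eigenvalues n).mono fun A hA => mem_closure_generic hn hA
end
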